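/- arXiv:1002.3893 — 2 statements merged into one kernel-verified Lean document; each statement's English description precedes it below -/
import Mathlib

section
/- Let M be a matroid on a finite ground set and let B1 and B2 be independent sets of M with |B1| = |B2|. Then there exists a bijection g : B1 \ B2 → B2 \ B1 such that for every e ∈ B1 \ B2, the set (B1 \ {e}) ∪ {g(e)} is independent in M. -/
/-- A matroid on a finite ground set `E`, given by its family of independent
(finite) sets, satisfying heredity and augmentation. -/
structure FinMatroid (E : Type*) [DecidableEq E] [Fintype E] where
  Indep : Finset E → Prop
  subset_indep : ∀ ⦃A B : Finset E⦄, Indep A → B ⊆ A → Indep B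
  augment : ∀ ⦃A B : Finset E⦄, Indep A → Indep B → B.card < A.card →
    ∃ e ∈ A \ B, Indep (insert e B)

/-- An independent set can be enlarged, by elements of another independent set `A` that is at
least as large, to an independent set of size `A.card`. -/
theorem FinMatroid.exists_indep_superset {E : Type*} [DecidableEq E] [Fintype E]
    (M : FinMatroid E) {A B : Finset E} (hA : M.Indep A) (hB : M.Indep B)
    (hBA : B.card ≤ A.card) :
    ∃ C, M.Indep C ∧ B ⊆ C ∧ C ⊆ A ∪ B ∧ C.card = A.card := by
  obtain h | h := hBA.eq_or_lt
  · exact ⟨B, hB, Finset.Subset.refl B, Finset.subset_union_right, h⟩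
  · obtain ⟨e, he, hi⟩ := M.augment hA hB h
    obtain ⟨heA, heB⟩ := Finset.mem_sdiff.1 he
    have hc : (insert e B).card = B.card + 1 := Finset.card_insert_of_notMem heB
    obtain ⟨C, hC, hBC, hCA, hcard⟩ := M.exists_indep_superset hA hi (by omega)
    refine ⟨C, hC, (Finset.subset_insert e B).trans hBC, hCA.trans ?_, hcard⟩
    intro x hx
    simp only [Finset.mem_union, Finset.mem_insert] at hx ⊢
    obtain hx | rfl | hx := hx <;> tauto
  termination_by A.card - B.card

/-- If `f` extends `B \ S` to an independent set, then `f` can replace some element of `S` in the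
independent set `B`. -/
theorem FinMatroid.exists_exchange {E : Type*} [DecidableEq E] [Fintype E]
    (M : FinMatroid E) {B S : Finset E} {f : E} (hB : M.Indep B) (hSB : S ⊆ B)
    (hS : S.Nonempty) (hf : f ∉ B) (hi : M.Indep (insert f (B \ S))) :
    ∃ e ∈ S, M.Indep (insert f (B.erase e)) := by
  have hc : (insert f (B \ S)).card ≤ B.card := by
    have h₁ := Finset.card_insert_le f (B \ S)
    have h₂ := Finset.card_sdiff_add_card_eq_card hSB
    have h₃ := hS.card_pos
    omega
  obtain ⟨C, hC, hBC, hCB, hcard⟩ := M.exists_indep_superset hB hi hc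
  have hfC : f ∈ C := hBC (Finset.mem_insert_self _ _)
  obtain ⟨e, heB, heC⟩ : ∃ e ∈ B, e ∉ C := by
    by_contra! h
    exact hf (Finset.eq_of_subset_of_card_le h hcard.le ▸ hfC)
  refine ⟨e, by_contra fun heS ↦ heC (hBC ?_), ?_⟩
  · exact Finset.mem_insert_of_mem (Finset.mem_sdiff.2 ⟨heB, heS⟩)
  · have hsub : C ⊆ insert f (B.erase e) := by
      intro x hx
      have hxe : x ≠ e := ne_of_mem_of_not_mem hx heC
      have := hCB hx
      simp only [Finset.mem_union, Finset.mem_insert, Finset.mem_sdiff, Finset.mem_erase] at this ⊢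
      tauto
    have hle : (insert f (B.erase e)).card ≤ C.card := by
      have h₁ := Finset.card_insert_le f (B.erase e)
      have h₂ := Finset.card_erase_add_one heB
      omega
    exact Finset.eq_of_subset_of_card_le hsub hle ▸ hC

/-- For independent sets `B1`, `B2` of equal size in a matroid,
there is a bijection `g : B1 \ B2 → B2 \ B1` such that for every `e ∈ B1 \ B2`,
the set `(B1 \ {e}) ∪ {g e}` is independent. -/
theorem matroid_equal_size_exchange_bijection
    {E : Type*} [DecidableEq E] [Fintype E] (M : FinMatroid E)
    (B1 B2 : Finset E) (h1 : M.Indep B1) (h2 : M.Indep B2)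
    (hcard : B1.card = B2.card) :
    ∃ g : {e // e ∈ B1 \ B2} → {e // e ∈ B2 \ B1},
      Function.Bijective g ∧
      ∀ e : {e // e ∈ B1 \ B2}, M.Indep (insert (g e).1 (B1.erase e.1)) := by
  classical
  let t : {e // e ∈ B1 \ B2} → Finset E := fun e ↦
    {f ∈ B2 \ B1 | M.Indep (insert f (B1.erase e.1))}
  have hall : ∀ s : Finset {e // e ∈ B1 \ B2}, s.card ≤ (s.biUnion t).card := by
    intro s
    obtain rfl | hs := s.eq_empty_or_nonempty
    · simp
    let S : Finset E := s.map (Function.Embedding.subtype _)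
    have hS : ∀ x ∈ S, x ∈ B1 ∧ x ∉ B2 := by
      intro x hx
      obtain ⟨e, -, rfl⟩ := Finset.mem_map.1 hx
      exact Finset.mem_sdiff.1 e.2
    have hSB : S ⊆ B1 := fun x hx ↦ (hS x hx).1
    have hScard : S.card = s.card := Finset.card_map _
    have hdiff := Finset.card_sdiff_add_card_eq_card hSB
    obtain ⟨C, hC, hBC, hCB, hCcard⟩ := M.exists_indep_superset h2
      (M.subset_indep h1 (Finset.sdiff_subset (t := S))) (by omega)
    have hCdiff := Finset.card_sdiff_add_card_eq_card hBC
    calc s.card = (C \ (B1 \ S)).card := by omega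
      _ ≤ (s.biUnion t).card := Finset.card_le_card fun f hf ↦ ?_
    obtain ⟨hfC, hfS⟩ := Finset.mem_sdiff.1 hf
    have hf2 : f ∈ B2 := (Finset.mem_union.1 (hCB hfC)).resolve_right hfS
    have hf1 : f ∉ B1 := fun h ↦
      hfS (Finset.mem_sdiff.2 ⟨h, fun hfS ↦ (hS f hfS).2 hf2⟩)
    obtain ⟨e, he, hi⟩ := M.exists_exchange h1 hSB (hs.map) hf1
      (M.subset_indep hC (Finset.insert_subset hfC hBC))
    obtain ⟨e, hes, rfl⟩ := Finset.mem_map.1 he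
    exact Finset.mem_biUnion.2
      ⟨e, hes, Finset.mem_filter.2 ⟨Finset.mem_sdiff.2 ⟨hf2, hf1⟩, hi⟩⟩
  obtain ⟨g, hg, hgt⟩ := (Finset.all_card_le_biUnion_card_iff_exists_injective t).1 hall
  refine ⟨fun e ↦ ⟨g e, (Finset.mem_filter.1 (hgt e)).1⟩, ?_,
    fun e ↦ (Finset.mem_filter.1 (hgt e)).2⟩
  refine (Fintype.bijective_iff_injective_and_card _).2
    ⟨fun a b h ↦ hg (congrArg Subtype.val h), ?_⟩
  simpa only [Fintype.card_coe] using Finset.card_sdiff_comm hcard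
end

section
/- Let F_1, …, F_m be Borel probability distributions on ℝ_{≥0} with finite mean and let μ be their product distribution on ℝ_{≥0}^m. Then the optimal lottery revenue under μ is at most twice the supremum, over all dominant-strategy incentive compatible, individually rational deterministic single-item auctions for m independent bidders with values v_j distributed according to F_j, of the expected revenue. -/
open MeasureTheory

/-- A lottery over `m` items: allocation probabilities `q` with `q j ≥ 0`,
`∑ j, q j ≤ 1`, and a price `p ≥ 0`. -/
structure Lottery (m : ℕ) where
  q : Fin m → ℝ
  p : ℝ
  q_nonneg : ∀ j, 0 ≤ q j
  q_sum_le_one : ∑ j, q j ≤ 1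
  p_nonneg : 0 ≤ p

/-- The (expected) utility of lottery `ℓ` at valuation `v`. -/
def Lottery.util {m : ℕ} (ℓ : Lottery m) (v : Fin m → ℝ) : ℝ :=
  (∑ j, ℓ.q j * v j) - ℓ.p

/-- The probability vector of a possibly-absent lottery (`⊥` ↦ 0). -/
def selQ {m : ℕ} : Option (Lottery m) → Fin m → ℝ
  | some ℓ => ℓ.q
  | none => 0

/-- The price of a possibly-absent lottery (`⊥` ↦ 0). -/
def selP {m : ℕ} : Option (Lottery m) → ℝ
  | some ℓ => ℓ.p
  | none => 0

/-- `s` is a utility-maximizing selection for the lottery menu `L`. -/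
structure IsSelection {m : ℕ} (L : Set (Lottery m))
    (s : (Fin m → ℝ) → Option (Lottery m)) : Prop where
  measQ : ∀ j, Measurable fun v => selQ (s v) j
  measP : Measurable fun v => selP (s v)
  buy_opt : ∀ v : Fin m → ℝ, (∀ j, 0 ≤ v j) → ∀ ℓ : Lottery m, s v = some ℓ →
    ℓ ∈ L ∧ 0 ≤ ℓ.util v ∧ ∀ ℓ' ∈ L, ℓ'.util v ≤ ℓ.util v
  no_buy : ∀ v : Fin m → ℝ, (∀ j, 0 ≤ v j) → s v = none →
    ∀ ℓ ∈ L, ℓ.util v ≤ 0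

/-- Expected revenue of a selection under the valuation distribution `μ`. -/
noncomputable def lotteryRevenue {m : ℕ} (μ : Measure (Fin m → ℝ))
    (s : (Fin m → ℝ) → Option (Lottery m)) : ℝ :=
  ∫ v, selP (s v) ∂μ

/-- An item pricing: every lottery in the menu allocates some item
deterministically (its probability vector is a standard basis vector). -/
def IsItemPricing {m : ℕ} (L : Set (Lottery m)) : Prop :=
  ∀ ℓ ∈ L, ∃ j : Fin m, ℓ.q = fun j' => if j' = j then 1 else 0

/-- The optimal item-pricing revenue under `μ`. -/
noncomputable def optItemPricingRev {m : ℕ} (μ : Measure (Fin m → ℝ)) : ℝ :=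
  sSup {r : ℝ | ∃ (L : Set (Lottery m)) (s : (Fin m → ℝ) → Option (Lottery m)),
    L.Nonempty ∧ IsItemPricing L ∧ IsSelection L s ∧ r = lotteryRevenue μ s}

/-- The optimal lottery revenue under `μ`. -/
noncomputable def optLotteryRev {m : ℕ} (μ : Measure (Fin m → ℝ)) : ℝ :=
  sSup {r : ℝ | ∃ (L : Set (Lottery m)) (s : (Fin m → ℝ) → Option (Lottery m)),
    L.Nonempty ∧ IsSelection L s ∧ r = lotteryRevenue μ s}

/-- A dominant-strategy incentive compatible, individually rational
deterministic single-item auction for `m` bidders: `x v = some j` means bidder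
`j` wins, `x v = none` means no winner; `pay v j ≥ 0` is bidder `j`'s payment. -/
structure IsAuction {m : ℕ} (x : (Fin m → ℝ) → Option (Fin m))
    (pay : (Fin m → ℝ) → Fin m → ℝ) : Prop where
  measX : ∀ j : Fin m, MeasurableSet {v | x v = some j}
  measPay : ∀ j : Fin m, Measurable fun v => pay v j
  pay_nonneg : ∀ v j, 0 ≤ pay v j
  ic : ∀ v : Fin m → ℝ, (∀ j, 0 ≤ v j) → ∀ (j : Fin m) (v' : ℝ), 0 ≤ v' →
    (if x (Function.update v j v') = some j then v j else 0)
        - pay (Function.update v j v') j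
      ≤ (if x v = some j then v j else 0) - pay v j
  ir : ∀ v : Fin m → ℝ, (∀ j, 0 ≤ v j) → ∀ j : Fin m,
    0 ≤ (if x v = some j then v j else 0) - pay v j

/-- Expected revenue of a single-item auction under `μ`. -/
noncomputable def auctionRevenue {m : ℕ} (μ : Measure (Fin m → ℝ))
    (pay : (Fin m → ℝ) → Fin m → ℝ) : ℝ :=
  ∫ v, ∑ j, pay v j ∂μ

section

lemma MonotoneOn.intervalIntegral_le_mul {f : ℝ → ℝ} (hf : MonotoneOn f (Set.Ici 0))
    {a b : ℝ} (ha : 0 ≤ a) (hb : 0 ≤ b) : ∫ t in a..b, f t ≤ (b - a) * f b := by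
  have hint : ∀ {a b : ℝ}, 0 ≤ a → 0 ≤ b → IntervalIntegrable f volume a b := fun ha hb =>
    (hf.mono fun x hx => le_trans (le_min ha hb) hx.1).intervalIntegrable
  rcases le_total a b with hab | hab
  · calc ∫ t in a..b, f t ≤ ∫ _ in a..b, f b :=
          intervalIntegral.integral_mono_on hab (hint ha hb) intervalIntegrable_const
            fun x hx => hf (ha.trans hx.1) hb hx.2
      _ = (b - a) * f b := by simp
  · rw [intervalIntegral.integral_symm]
    have : ∫ _ in b..a, f b ≤ ∫ t in b..a, f t :=
      intervalIntegral.integral_mono_on hab intervalIntegrable_const (hint hb ha)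
        fun x hx => hf hb (hb.trans hx.1) hx.1
    simp only [intervalIntegral.integral_const, smul_eq_mul] at this
    linarith

/-- One direction of the envelope formula: the integral of a bounded selection of subgradients of a
nonnegative function on `[0, b]` is at most the value of the function at `b`. -/
lemma intervalIntegral_subgradient_le {g u : ℝ → ℝ}
    (hsub : ∀ a b, 0 ≤ a → 0 ≤ b → u a + g a * (b - a) ≤ u b)
    (hg0 : ∀ a, 0 ≤ a → 0 ≤ g a) (hg1 : ∀ a, 0 ≤ a → g a ≤ 1) (hu : ∀ a, 0 ≤ a → 0 ≤ u a)
    {b : ℝ} (hb : 0 ≤ b) : ∫ t in (0 : ℝ)..b, g t ≤ u b := by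
  have hu_mono : MonotoneOn u (Set.Ici 0) := fun x hx y hy hxy => by
    have := hsub x y hx hy
    have := mul_nonneg (hg0 x hx) (sub_nonneg.2 hxy)
    linarith
  have hg_mono : MonotoneOn g (Set.Ici 0) := fun x hx y hy hxy => by
    rcases hxy.eq_or_lt with rfl | hlt
    · rfl
    · have h1 := hsub x y hx hy
      have h2 := hsub y x hy hx
      by_contra! h
      nlinarith [mul_pos (sub_pos.2 h) (sub_pos.2 hlt)]
  have hint : ∀ {f : ℝ → ℝ}, MonotoneOn f (Set.Ici 0) → ∀ {a b : ℝ}, 0 ≤ a → 0 ≤ b →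
      IntervalIntegrable f volume a b := fun hf _ _ ha hb =>
    (hf.mono fun x hx => le_trans (le_min ha hb) hx.1).intervalIntegrable
  refine le_of_forall_pos_le_add fun ε hε => ?_
  have hshift : IntervalIntegrable (fun t => u (t + ε)) volume 0 b :=
    MonotoneOn.intervalIntegrable fun x hx y hy hxy => by
      rw [Set.uIcc_of_le hb] at hx hy
      exact hu_mono (add_nonneg hx.1 hε.le) (add_nonneg hy.1 hε.le) (by linarith)
  have h1 : ∫ t in (0 : ℝ)..b, ε * g t ≤ ∫ t in (0 : ℝ)..b, (u (t + ε) - u t) := by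
    refine intervalIntegral.integral_mono_on hb ((hint hg_mono le_rfl hb).const_mul ε)
      (hshift.sub (hint hu_mono le_rfl hb)) fun t ht => ?_
    have := hsub t (t + ε) ht.1 (add_nonneg ht.1 hε.le)
    linarith
  rw [intervalIntegral.integral_const_mul,
    intervalIntegral.integral_sub hshift (hint hu_mono le_rfl hb),
    intervalIntegral.integral_comp_add_right u ε, zero_add] at h1
  have hbε : 0 ≤ b + ε := by linarith
  have h2 := intervalIntegral.integral_add_adjacent_intervals
    (hint hu_mono le_rfl hε.le) (hint hu_mono hε.le hbε)
  have h3 := intervalIntegral.integral_add_adjacent_intervals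
    (hint hu_mono le_rfl hb) (hint hu_mono hb hbε)
  have h4 : 0 ≤ ∫ t in (0 : ℝ)..ε, u t :=
    intervalIntegral.integral_nonneg hε.le fun t ht => hu t ht.1
  have h5 := hu_mono.intervalIntegral_le_mul hb hbε
  have h6 := hsub (b + ε) b hbε hb
  have h7 := hg1 (b + ε) hbε
  have h8 : ε * ∫ t in (0 : ℝ)..b, g t ≤ ε * (u b + ε) := by
    have h9 := mul_le_mul_of_nonneg_left h7 hε.le
    nlinarith
  exact le_of_mul_le_mul_left h8 hε

variable {m : ℕ}

lemma measurable_update_pair (j : Fin m) :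
    Measurable fun p : (Fin m → ℝ) × ℝ => Function.update p.1 j p.2 := by
  refine measurable_pi_iff.2 fun i => ?_
  by_cases h : i = j
  · subst h; simpa using measurable_snd
  · simpa [h, Function.comp_def] using (measurable_pi_apply i).comp measurable_fst

lemma update_nonneg {v : Fin m → ℝ} (hv : ∀ i, 0 ≤ v i) (j : Fin m) {t : ℝ} (ht : 0 ≤ t)
    (i : Fin m) : 0 ≤ Function.update v j t i := by
  by_cases h : i = j
  · subst h; simpa
  · simpa [h] using hv i

/-- The payment of bidder `j` who wins exactly on `A` prescribed by the payment identity. -/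
noncomputable def identityPay (A : Set (Fin m → ℝ)) (j : Fin m) (v : Fin m → ℝ) : ℝ :=
  v j * A.indicator 1 v - ∫ t in (0 : ℝ)..v j, A.indicator 1 (Function.update v j t)

/-- On nonnegative vectors, raising coordinate `j` does not leave `A`. -/
def IsMonotoneAlong (A : Set (Fin m → ℝ)) (j : Fin m) : Prop :=
  ∀ v : Fin m → ℝ, (∀ i, 0 ≤ v i) → ∀ t, v j ≤ t → v ∈ A → Function.update v j t ∈ A

section

variable {A : Set (Fin m → ℝ)} {j : Fin m} {v : Fin m → ℝ}

lemma IsMonotoneAlong.monotoneOn_indicator (hA : IsMonotoneAlong A j) (hv : ∀ i, 0 ≤ v i) :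
    MonotoneOn (fun t => A.indicator (1 : (Fin m → ℝ) → ℝ) (Function.update v j t))
      (Set.Ici 0) := by
  intro a ha b hb hab
  have := hA _ (update_nonneg hv j ha) b (by simpa using hab)
  rw [Function.update_idem] at this
  by_cases h : Function.update v j a ∈ A
  · simp [h, this h]
  · simp only [Set.indicator_of_notMem h]
    exact Set.indicator_nonneg (fun _ _ => zero_le_one) _

lemma IsMonotoneAlong.identityPay_nonneg (hA : IsMonotoneAlong A j) (hv : ∀ i, 0 ≤ v i) :
    0 ≤ identityPay A j v := by
  have := (hA.monotoneOn_indicator hv).intervalIntegral_le_mul le_rfl (hv j)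
  simp only [Function.update_eq_self, sub_zero] at this
  exact sub_nonneg.2 this

lemma identityPay_le (hv : ∀ i, 0 ≤ v i) : identityPay A j v ≤ v j * A.indicator 1 v :=
  sub_le_self _ <| intervalIntegral.integral_nonneg (hv j) fun _ _ =>
    Set.indicator_nonneg (fun _ _ => zero_le_one) _

lemma identityPay_le_apply (hv : ∀ i, 0 ≤ v i) : identityPay A j v ≤ v j :=
  (identityPay_le hv).trans <| mul_le_of_le_one_right (hv j) <|
    Set.indicator_le_self' (fun _ _ => zero_le_one) _

lemma IsMonotoneAlong.identityPay_ic (hA : IsMonotoneAlong A j) (hv : ∀ i, 0 ≤ v i)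
    {t : ℝ} (ht : 0 ≤ t) :
    v j * A.indicator 1 (Function.update v j t) - identityPay A j (Function.update v j t) ≤
      v j * A.indicator 1 v - identityPay A j v := by
  have hmono := hA.monotoneOn_indicator hv
  have h := hmono.intervalIntegral_le_mul (hv j) ht
  have hint : ∀ {a b : ℝ}, 0 ≤ a → 0 ≤ b → IntervalIntegrable
      (fun t => A.indicator (1 : (Fin m → ℝ) → ℝ) (Function.update v j t)) volume a b :=
    fun ha hb => (hmono.mono fun x hx => le_trans (le_min ha hb) hx.1).intervalIntegrable
  have h2 := intervalIntegral.integral_add_adjacent_intervals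
    (hint le_rfl (hv j)) (hint (hv j) ht)
  simp only [identityPay, Function.update_self, Function.update_idem]
  linarith

end

lemma measurable_identityPay {α : Type*} [MeasurableSpace α] {A : α → Set (Fin m → ℝ)}
    (hA : MeasurableSet {p : (Fin m → ℝ) × α | p.1 ∈ A p.2}) (j : Fin m) :
    Measurable fun p : (Fin m → ℝ) × α => identityPay (A p.2) j p.1 := by
  have hind : Measurable fun p : (Fin m → ℝ) × α => (A p.2).indicator (1 : (Fin m → ℝ) → ℝ) p.1 :=
    (measurable_one (α := ℝ)).indicator hA
  have hj : Measurable fun p : (Fin m → ℝ) × α => p.1 j :=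
    (measurable_pi_apply j).comp measurable_fst
  refine (hj.mul hind).sub ?_
  have hscale : ∀ p : (Fin m → ℝ) × α,
      ∫ t in (0 : ℝ)..p.1 j, (A p.2).indicator (1 : (Fin m → ℝ) → ℝ) (Function.update p.1 j t) =
        p.1 j * ∫ t in Set.Ioc (0 : ℝ) 1,
          (A p.2).indicator (1 : (Fin m → ℝ) → ℝ) (Function.update p.1 j (t * p.1 j)) := by
    intro p
    rw [← intervalIntegral.integral_of_le zero_le_one,
      intervalIntegral.mul_integral_comp_mul_right (p.1 j)
        (f := fun t => (A p.2).indicator (1 : (Fin m → ℝ) → ℝ) (Function.update p.1 j t)),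
      zero_mul, one_mul]
  simp_rw [hscale]
  refine hj.mul (StronglyMeasurable.integral_prod_right ?_).measurable
  refine (hind.comp (g := fun p : (Fin m → ℝ) × α => (A p.2).indicator (1 : (Fin m → ℝ) → ℝ) p.1)
    (f := fun x : ((Fin m → ℝ) × α) × ℝ => (Function.update x.1.1 j (x.2 * x.1.1 j), x.1.2))
    (Measurable.prodMk ?_ (measurable_snd.comp measurable_fst))).stronglyMeasurable
  exact (measurable_update_pair j).comp ((measurable_fst.comp measurable_fst).prodMk
    (measurable_snd.mul (hj.comp measurable_fst)))

/-- Coordinatewise positive part. -/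
def posVec (v : Fin m → ℝ) : Fin m → ℝ := fun i => max (v i) 0

lemma posVec_nonneg (v : Fin m → ℝ) (i : Fin m) : 0 ≤ posVec v i := le_max_right _ _

lemma posVec_of_nonneg {v : Fin m → ℝ} (hv : ∀ i, 0 ≤ v i) : posVec v = v :=
  funext fun i => max_eq_left (hv i)

lemma measurable_posVec : Measurable (posVec (m := m)) :=
  measurable_pi_iff.2 fun i => (measurable_pi_apply i).max measurable_const

/-- Disjoint monotone winning regions are implemented by the payments of the payment identity. -/
lemma exists_isAuction {A : Fin m → Set (Fin m → ℝ)} (hmeas : ∀ j, MeasurableSet (A j))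
    (hdisj : ∀ v i j, v ∈ A i → v ∈ A j → i = j) (hmono : ∀ j, IsMonotoneAlong (A j) j) :
    ∃ x : (Fin m → ℝ) → Option (Fin m),
      IsAuction x fun v j => identityPay (A j) j (posVec v) := by
  classical
  let x : (Fin m → ℝ) → Option (Fin m) := fun v =>
    if h : ∃ j, v ∈ A j then some h.choose else none
  have hx : ∀ v j, x v = some j ↔ v ∈ A j := by
    intro v j
    by_cases h : ∃ j, v ∈ A j
    · simp only [x, h, dif_pos, Option.some.injEq]
      exact ⟨fun e => e ▸ h.choose_spec, fun hj => hdisj _ _ _ h.choose_spec hj⟩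
    · simpa [x, h] using fun hj => h ⟨j, hj⟩
  have hif : ∀ v j (c : ℝ), (if x v = some j then c else 0) = c * (A j).indicator 1 v := by
    intro v j c
    by_cases h : v ∈ A j <;> simp [hx, h]
  refine ⟨x, fun j => ?_, fun j => ?_, fun v j => ?_, fun v hv j t ht => ?_, fun v hv j => ?_⟩
  · simp only [hx]
    exact hmeas j
  · exact (measurable_identityPay (α := Unit) (A := fun _ => A j)
      ((hmeas j).preimage measurable_fst) j).comp (measurable_posVec.prodMk 
        (measurable_const (a := ())))
  · exact (hmono j).identityPay_nonneg (posVec_nonneg v)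
  · rw [hif, hif, posVec_of_nonneg hv, posVec_of_nonneg (update_nonneg hv j ht)]
    exact (hmono j).identityPay_ic hv ht
  · rw [hif, posVec_of_nonneg hv]
    exact sub_nonneg.2 (identityPay_le hv)

/-- The valuations whose largest coordinate is `j`, ties being won by the smallest index. -/
def topSet (j : Fin m) : Set (Fin m → ℝ) := {v | ∀ i, v i ≤ v j ∧ (i < j → v i < v j)}

lemma measurableSet_topSet (j : Fin m) : MeasurableSet (topSet j) := by
  have : topSet j = ⋂ i, {v : Fin m → ℝ | v i ≤ v j} ∩ {v | i < j → v i < v j} := by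
    ext; simp [topSet]
  rw [this]
  refine MeasurableSet.iInter fun i => (measurableSet_le (measurable_pi_apply i)
    (measurable_pi_apply j)).inter ?_
  by_cases h : i < j
  · simpa [h] using measurableSet_lt (measurable_pi_apply i) (measurable_pi_apply j)
  · simp [h]

lemma topSet_disjoint (v : Fin m → ℝ) (i j : Fin m) (hi : v ∈ topSet i) (hj : v ∈ topSet j) :
    i = j := by
  rcases lt_trichotomy i j with h | h | h
  · exact absurd ((hj i).2 h) (hi j).1.not_gt
  · exact h
  · exact absurd ((hi j).2 h) (hj i).1.not_gt

lemma isMonotoneAlong_topSet (j : Fin m) : IsMonotoneAlong (topSet j) j := by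
  intro v _ t ht h i
  by_cases hij : i = j
  · subst hij; simp
  · simpa [hij] using
      ⟨(h i).1.trans ht, fun hlt => ((h i).2 hlt).trans_le ht⟩

lemma exists_mem_topSet [NeZero m] (v : Fin m → ℝ) : ∃ j, v ∈ topSet j := by
  obtain ⟨k, hk⟩ := Finite.exists_max v
  obtain ⟨j, hj, hmin⟩ := WellFounded.has_min (wellFounded_lt (α := Fin m)) {j | v k ≤ v j}
    ⟨k, le_refl (v k)⟩
  exact ⟨j, fun i => ⟨(hk i).trans hj, fun hij => by
    by_contra! h
    exact hmin i (le_trans hj h) hij⟩⟩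

lemma le_identityPay_topSet {v : Fin m → ℝ} (hv : ∀ i, 0 ≤ v i) {i j : Fin m} (hij : i ≠ j)
    (h : v ∈ topSet j) : v i ≤ identityPay (topSet j) j v := by
  have hmono := (isMonotoneAlong_topSet j).monotoneOn_indicator hv
  have hint : ∀ {a b : ℝ}, 0 ≤ a → 0 ≤ b → IntervalIntegrable
      (fun t => (topSet j).indicator (1 : (Fin m → ℝ) → ℝ) (Function.update v j t)) volume a b :=
    fun ha hb => (hmono.mono fun x hx => le_trans (le_min ha hb) hx.1).intervalIntegrable
  have h1 : ∫ t in (0 : ℝ)..v i,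
      (topSet j).indicator (1 : (Fin m → ℝ) → ℝ) (Function.update v j t) = 0 := by
    refine (intervalIntegral.integral_congr_ae' ?_ ?_).trans intervalIntegral.integral_zero
    · have : ∀ᵐ t : ℝ, t ≠ v i := by simp [ae_iff]
      filter_upwards [this] with t ht hmem
      refine Set.indicator_of_notMem (fun hmem' => ?_) _
      have := (hmem' i).1
      rw [Function.update_self, Function.update_of_ne hij] at this
      exact ht (le_antisymm hmem.2 this)
    · filter_upwards with t ht
      exact absurd (ht.1.trans_le ht.2) (hv i).not_gt
  have h2 := hmono.intervalIntegral_le_mul (hv i) (hv j)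
  have h3 := intervalIntegral.integral_add_adjacent_intervals
    (hint le_rfl (hv i)) (hint (hv i) (hv j))
  simp only [Function.update_eq_self, Set.indicator_of_mem h, Pi.one_apply] at h2
  simp only [identityPay, Set.indicator_of_mem h, Pi.one_apply]
  linarith

lemma selQ_nonneg (o : Option (Lottery m)) (j : Fin m) : 0 ≤ selQ o j := by
  cases o with
  | none => exact le_rfl
  | some ℓ => exact ℓ.q_nonneg j

lemma sum_selQ_le_one (o : Option (Lottery m)) : ∑ j, selQ o j ≤ 1 := by
  cases o with
  | none => simp [selQ]
  | some ℓ => exact ℓ.q_sum_le_one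

lemma selQ_le_one (o : Option (Lottery m)) (j : Fin m) : selQ o j ≤ 1 :=
  (Finset.single_le_sum (fun i _ => selQ_nonneg o i) (Finset.mem_univ j)).trans
    (sum_selQ_le_one o)

lemma selP_nonneg (o : Option (Lottery m)) : 0 ≤ selP o := by
  cases o with
  | none => exact le_rfl
  | some ℓ => exact ℓ.p_nonneg

/-- The utility obtained at `v` under the selection `s`. -/
noncomputable def selUtil (s : (Fin m → ℝ) → Option (Lottery m)) (v : Fin m → ℝ) : ℝ :=
  ∑ j, selQ (s v) j * v j - selP (s v)

/-- The region won by item `j` when it must be the top item and be allotted with probability more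
than `c`. -/
def winSet (s : (Fin m → ℝ) → Option (Lottery m)) (c : ℝ) (j : Fin m) : Set (Fin m → ℝ) :=
  {v | v ∈ topSet j ∧ c < selQ (s v) j}

namespace IsSelection

variable {L : Set (Lottery m)} {s : (Fin m → ℝ) → Option (Lottery m)} {v w : Fin m → ℝ} {j : Fin m}

lemma selUtil_nonneg (hs : IsSelection L s) (hv : ∀ i, 0 ≤ v i) : 0 ≤ selUtil s v := by
  unfold selUtil
  rcases h : s v with _ | ℓ
  · simp [selQ, selP]
  · exact (hs.buy_opt v hv ℓ h).2.1

lemma le_selUtil (hs : IsSelection L s) (hv : ∀ i, 0 ≤ v i) (hw : ∀ i, 0 ≤ w i) :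
    ∑ j, selQ (s w) j * v j - selP (s w) ≤ selUtil s v := by
  rcases h : s w with _ | ℓ
  · simpa [selQ, selP] using hs.selUtil_nonneg hv
  · have hmem := (hs.buy_opt w hw ℓ h).1
    unfold selUtil
    rcases h' : s v with _ | ℓ'
    · simpa [selQ, selP, Lottery.util] using hs.no_buy v hv h' ℓ hmem
    · exact (hs.buy_opt v hv ℓ' h').2.2 ℓ hmem

lemma selUtil_update_add_le (hs : IsSelection L s) (hv : ∀ i, 0 ≤ v i) (j : Fin m) {a b : ℝ}
    (ha : 0 ≤ a) (hb : 0 ≤ b) :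
    selUtil s (Function.update v j a) + selQ (s (Function.update v j a)) j * (b - a) ≤
      selUtil s (Function.update v j b) := by
  refine le_trans (le_of_eq ?_) (hs.le_selUtil (update_nonneg hv j hb) (update_nonneg hv j ha))
  have : ∑ i, (selQ (s (Function.update v j a)) i * Function.update v j b i -
      selQ (s (Function.update v j a)) i * Function.update v j a i) =
      selQ (s (Function.update v j a)) j * (b - a) := by
    rw [Finset.sum_eq_single j (fun i _ hi => by simp [hi]) (by simp)]
    simp [mul_sub]
  rw [Finset.sum_sub_distrib] at this
  unfold selUtil
  linarith

lemma isMonotoneAlong_winSet (hs : IsSelection L s) (c : ℝ) (j : Fin m) :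
    IsMonotoneAlong (winSet s c j) j := by
  intro v hv t ht ⟨h1, h2⟩
  refine ⟨isMonotoneAlong_topSet j v hv t ht h1, h2.trans_le ?_⟩
  rcases ht.eq_or_lt with rfl | hlt
  · simp
  · have ht0 : 0 ≤ t := (hv j).trans ht
    have h3 := hs.selUtil_update_add_le hv j (hv j) ht0
    have h4 := hs.selUtil_update_add_le hv j ht0 (hv j)
    rw [Function.update_eq_self] at h3 h4
    by_contra! h
    nlinarith [mul_pos (sub_pos.2 h) (sub_pos.2 hlt)]

lemma measurableSet_winSet (hs : IsSelection L s) (j : Fin m) :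
    MeasurableSet {p : (Fin m → ℝ) × ℝ | p.1 ∈ winSet s p.2 j} :=
  ((measurableSet_topSet j).preimage measurable_fst).inter
    (measurableSet_lt measurable_snd ((hs.measQ j).comp measurable_fst))

end IsSelection

lemma integral_indicator_lt_eq {q : ℝ} (h0 : 0 ≤ q) (h1 : q ≤ 1) :
    ∫ c in Set.Ioc (0 : ℝ) 1, (Set.Iio q).indicator (1 : ℝ → ℝ) c = q := by
  rw [integral_indicator_one measurableSet_Iio, measureReal_restrict_apply measurableSet_Iio,
    show Set.Iio q ∩ Set.Ioc 0 1 = Set.Ioo 0 q by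
      ext x
      simp only [Set.mem_inter_iff, Set.mem_Iio, Set.mem_Ioc, Set.mem_Ioo]
      exact ⟨fun h => ⟨h.2.1, h.1⟩, fun h => ⟨h.2, h.1, by linarith⟩⟩]
  simp [h0]

lemma norm_indicator_one_le {α : Type*} (S : Set α) (x : α) :
    ‖S.indicator (1 : α → ℝ) x‖ ≤ 1 := by
  by_cases h : x ∈ S <;> simp [h]

/-- Averaged over a uniform probability threshold, the payment of the top item is at least its
contribution to the welfare minus the utility of the buyer. -/
lemma IsSelection.le_integral_identityPay {L : Set (Lottery m)}
    {s : (Fin m → ℝ) → Option (Lottery m)} (hs : IsSelection L s) {v : Fin m → ℝ}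
    (hv : ∀ i, 0 ≤ v i) {j : Fin m} (hj : v ∈ topSet j) :
    v j * selQ (s v) j - selUtil s v ≤
      ∫ c in Set.Ioc (0 : ℝ) 1, identityPay (winSet s c j) j v := by
  set g : ℝ → ℝ := fun t => selQ (s (Function.update v j t)) j with hg
  have hg_meas : Measurable g := (hs.measQ j).comp (measurable_update v)
  have hgv : g (v j) = selQ (s v) j := by simp [hg]
  let ι : ℝ → ℝ → ℝ := fun c t => (Set.Iio (g t)).indicator (1 : ℝ → ℝ) c
  have hι_meas : Measurable (Function.uncurry ι) :=
    (measurable_one (α := ℝ)).indicator (s := {p : ℝ × ℝ | p.1 < g p.2})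
      (measurableSet_lt measurable_fst (hg_meas.comp measurable_snd))
  have hι_int : Integrable (Function.uncurry ι)
      ((volume.restrict (Set.Ioc (0 : ℝ) 1)).prod (volume.restrict (Set.Ioc 0 (v j)))) :=
    Integrable.of_bound hι_meas.aestronglyMeasurable 1
      (.of_forall fun p => norm_indicator_one_le _ _)
  have hι_left : Integrable (fun c => ι c (v j)) (volume.restrict (Set.Ioc (0 : ℝ) 1)) :=
    Integrable.of_bound (hι_meas.comp (measurable_id.prodMk measurable_const)).aestronglyMeasurable 1
      (.of_forall fun c => norm_indicator_one_le _ _)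
  have hpay_int : Integrable (fun c => identityPay (winSet s c j) j v)
      (volume.restrict (Set.Ioc (0 : ℝ) 1)) := by
    have hmeas : Measurable fun c => identityPay (winSet s c j) j v :=
      (measurable_identityPay (A := fun c => winSet s c j) (hs.measurableSet_winSet j) j).comp
        (measurable_const.prodMk measurable_id)
    refine Integrable.of_bound hmeas.aestronglyMeasurable (v j) (.of_forall fun c => ?_)
    rw [Real.norm_of_nonneg ((hs.isMonotoneAlong_winSet c j).identityPay_nonneg hv)]
    exact identityPay_le_apply hv
  have hι_left' : Integrable (fun c => ∫ t in Set.Ioc 0 (v j), ι c t)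
      (volume.restrict (Set.Ioc (0 : ℝ) 1)) := hι_int.integral_prod_left
  have hswap : ∫ c in Set.Ioc (0 : ℝ) 1, ∫ t in Set.Ioc 0 (v j), ι c t ≤ selUtil s v := by
    rw [integral_integral_swap hι_int]
    simp only [ι, integral_indicator_lt_eq (selQ_nonneg _ j) (selQ_le_one _ j), hg]
    rw [← intervalIntegral.integral_of_le (hv j)]
    refine (intervalIntegral_subgradient_le (g := g)
      (u := fun t => selUtil s (Function.update v j t))
      (fun a b ha hb => hs.selUtil_update_add_le hv j ha hb) (fun _ _ => selQ_nonneg _ j)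
      (fun _ _ => selQ_le_one _ j) (fun t ht => hs.selUtil_nonneg (update_nonneg hv j ht))
      (hv j)).trans_eq ?_
    simp
  have hmono : ∫ c in Set.Ioc (0 : ℝ) 1, (v j * ι c (v j) - ∫ t in Set.Ioc 0 (v j), ι c t) ≤
      ∫ c in Set.Ioc (0 : ℝ) 1, identityPay (winSet s c j) j v := by
    refine integral_mono ((hι_left.const_mul _).sub hι_left') hpay_int fun c => ?_
    have h1 : (winSet s c j).indicator (1 : (Fin m → ℝ) → ℝ) v = ι c (v j) := by
      by_cases h : c < selQ (s v) j <;> simp [ι, hgv, winSet, Set.indicator, hj, h]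
    simp only [identityPay, h1, intervalIntegral.integral_of_le (hv j)]
    refine sub_le_sub_left (integral_mono_of_nonneg
      (.of_forall fun t => Set.indicator_nonneg (fun _ _ => zero_le_one) _) ?_
      (.of_forall fun t => ?_)) _
    · exact Integrable.of_bound (hι_meas.comp
        (measurable_const.prodMk measurable_id)).aestronglyMeasurable 1
        (.of_forall fun t => norm_indicator_one_le _ _)
    · by_cases h : Function.update v j t ∈ winSet s c j
      · have h2 : c < g t := h.2
        simp [ι, h, h2]
      · simp only [Set.indicator_of_notMem h]
        exact Set.indicator_nonneg (fun _ _ => zero_le_one) _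
  rw [integral_sub (hι_left.const_mul _) hι_left', integral_const_mul,
    integral_indicator_lt_eq (selQ_nonneg _ j) (selQ_le_one _ j), Function.update_eq_self] at hmono
  linarith

lemma IsSelection.selP_le_add {L : Set (Lottery m)}
    {s : (Fin m → ℝ) → Option (Lottery m)} (hs : IsSelection L s) {v : Fin m → ℝ}
    (hv : ∀ i, 0 ≤ v i) :
    selP (s v) ≤ (∑ j, ∫ c in Set.Ioc (0 : ℝ) 1, identityPay (winSet s c j) j v) +
      ∑ j, identityPay (topSet j) j v := by
  have hutil := hs.selUtil_nonneg hv
  rcases eq_or_ne m 0 with rfl | hm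
  · simpa [selUtil] using hutil
  have : NeZero m := ⟨hm⟩
  obtain ⟨j, hj⟩ := exists_mem_topSet v
  have h1 := hs.le_integral_identityPay hv hj
  have h2 := Finset.single_le_sum
    (f := fun j => ∫ c in Set.Ioc (0 : ℝ) 1, identityPay (winSet s c j) j v)
    (fun i _ => integral_nonneg fun c => (hs.isMonotoneAlong_winSet c i).identityPay_nonneg hv)
    (Finset.mem_univ j)
  have h3 := Finset.single_le_sum (f := fun j => identityPay (topSet j) j v)
    (fun i _ => (isMonotoneAlong_topSet i).identityPay_nonneg hv) (Finset.mem_univ j)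
  have h0 := (isMonotoneAlong_topSet j).identityPay_nonneg hv
  have h4 : ∑ i ∈ Finset.univ.erase j, selQ (s v) i * v i ≤ identityPay (topSet j) j v :=
    calc ∑ i ∈ Finset.univ.erase j, selQ (s v) i * v i
        ≤ ∑ i ∈ Finset.univ.erase j, selQ (s v) i * identityPay (topSet j) j v :=
          Finset.sum_le_sum fun i hi => mul_le_mul_of_nonneg_left
            (le_identityPay_topSet hv (Finset.ne_of_mem_erase hi) hj) (selQ_nonneg _ _)
      _ ≤ ∑ i, selQ (s v) i * identityPay (topSet j) j v :=
          Finset.sum_le_sum_of_subset_of_nonneg (Finset.erase_subset _ _)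
            fun i _ _ => mul_nonneg (selQ_nonneg _ _) h0
      _ ≤ identityPay (topSet j) j v := by
          rw [← Finset.sum_mul]
          exact mul_le_of_le_one_left h0 (sum_selQ_le_one _)
  have h5 := Finset.add_sum_erase Finset.univ (fun i => selQ (s v) i * v i) (Finset.mem_univ j)
  simp only [selUtil] at h1
  linarith

lemma ae_pi_nonneg (F : Fin m → Measure ℝ) [∀ j, IsProbabilityMeasure (F j)]
    (hF_nonneg : ∀ j, F j (Set.Iio 0) = 0) : ∀ᵐ v ∂Measure.pi F, ∀ i, 0 ≤ v i := by
  refine ae_all_iff.2 fun i => (measurePreserving_eval F i).quasiMeasurePreserving.ae ?_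
  simpa [ae_iff, Set.Iio] using hF_nonneg i

/-- Auction revenues are bounded by the expected sum of the values. -/
lemma bddAbove_auctionRevenue (F : Fin m → Measure ℝ) [∀ j, IsProbabilityMeasure (F j)]
    (hF_nonneg : ∀ j, F j (Set.Iio 0) = 0) (hF_mean : ∀ j, Integrable id (F j)) :
    BddAbove {r : ℝ | ∃ (x : (Fin m → ℝ) → Option (Fin m)) (pay : (Fin m → ℝ) → Fin m → ℝ),
      IsAuction x pay ∧ r = auctionRevenue (Measure.pi F) pay} := by
  refine ⟨∫ v, ∑ j, v j ∂Measure.pi F, ?_⟩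
  rintro r ⟨x, pay, h, rfl⟩
  refine integral_mono_of_nonneg (.of_forall fun v => Finset.sum_nonneg fun j _ => h.pay_nonneg v j)
    (integrable_finsetSum _ fun j _ => integrable_comp_eval (f := id) (hF_mean j)) ?_
  filter_upwards [ae_pi_nonneg F hF_nonneg] with v hv
  refine Finset.sum_le_sum fun j _ => ?_
  have h1 := h.ir v hv j
  split_ifs at h1 <;> linarith [hv j]

end

/-- For a single unit-demand buyer with independent item
values `v j ∼ F j` (Borel distributions on `ℝ≥0` with finite mean), the optimal
lottery revenue is at most twice the supremum, over all IC, IR deterministic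
single-item auctions for `m` independent bidders with values `v j ∼ F j`, of
the expected revenue. -/
theorem optLottery_le_two_auctionSup
    {m : ℕ} (F : Fin m → Measure ℝ) [∀ j, IsProbabilityMeasure (F j)]
    (hF_nonneg : ∀ j, F j (Set.Iio 0) = 0)
    (hF_mean : ∀ j, Integrable id (F j)) :
    optLotteryRev (Measure.pi F) ≤
      2 * sSup {r : ℝ | ∃ (x : (Fin m → ℝ) → Option (Fin m))
        (pay : (Fin m → ℝ) → Fin m → ℝ),
        IsAuction x pay ∧ r = auctionRevenue (Measure.pi F) pay} := by
  set S := {r : ℝ | ∃ (x : (Fin m → ℝ) → Option (Fin m)) (pay : (Fin m → ℝ) → Fin m → ℝ),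
    IsAuction x pay ∧ r = auctionRevenue (Measure.pi F) pay}
  have hbdd : BddAbove S := bddAbove_auctionRevenue F hF_nonneg hF_mean
  have hsup : 0 ≤ sSup S := Real.sSup_nonneg fun r => by
    rintro ⟨x, pay, h, rfl⟩
    exact integral_nonneg fun v => Finset.sum_nonneg fun j _ => h.pay_nonneg v j
  refine Real.sSup_le ?_ (by positivity)
  rintro r ⟨L, s, -, hs, rfl⟩
  have hrev : ∀ A : Fin m → Set (Fin m → ℝ), (∀ j, MeasurableSet (A j)) →
      (∀ j, A j ⊆ topSet j) → (∀ j, IsMonotoneAlong (A j) j) →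
      ∫ v, ∑ j, identityPay (A j) j (posVec v) ∂Measure.pi F ≤ sSup S := by
    intro A hmeas hsub hmono
    obtain ⟨x, hx⟩ := exists_isAuction hmeas
      (fun v i j hi hj => topSet_disjoint v i j (hsub i hi) (hsub j hj)) hmono
    exact le_csSup hbdd ⟨x, _, hx, rfl⟩
  have hvick := hrev topSet measurableSet_topSet (fun _ => subset_rfl) isMonotoneAlong_topSet
  have hwin : ∀ c, ∫ v, ∑ j, identityPay (winSet s c j) j (posVec v) ∂Measure.pi F ≤ sSup S :=
    fun c => hrev (winSet s c)
      (fun j => (hs.measurableSet_winSet j).preimage (measurable_id.prodMk measurable_const))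
      (fun j v hv => hv.1) (hs.isMonotoneAlong_winSet c)
  have hpos_int : ∀ j, Integrable (fun v => posVec v j) (Measure.pi F) := fun j =>
    (integrable_comp_eval (f := id) (hF_mean j)).pos_part
  have hwin_int : ∀ j, Integrable
      (fun p : (Fin m → ℝ) × ℝ => identityPay (winSet s p.2 j) j (posVec p.1))
      ((Measure.pi F).prod (volume.restrict (Set.Ioc (0 : ℝ) 1))) := by
    intro j
    refine ((hpos_int j).comp_fst _).mono'
      ((measurable_identityPay (A := fun c => winSet s c j) (hs.measurableSet_winSet j) j).comp
        ((measurable_posVec.comp measurable_fst).prodMk measurable_snd)).aestronglyMeasurable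
      (.of_forall fun p => ?_)
    rw [Real.norm_of_nonneg
      ((hs.isMonotoneAlong_winSet p.2 j).identityPay_nonneg (posVec_nonneg p.1))]
    exact identityPay_le_apply (posVec_nonneg p.1)
  have hvick_int : ∀ j, Integrable (fun v => identityPay (topSet j) j (posVec v))
      (Measure.pi F) := by
    intro j
    refine (hpos_int j).mono' ((measurable_identityPay (α := Unit) (A := fun _ => topSet j)
      ((measurableSet_topSet j).preimage measurable_fst) j).comp (measurable_posVec.prodMk
        (measurable_const (a := ())))).aestronglyMeasurable (.of_forall fun v => ?_)
    rw [Real.norm_of_nonneg ((isMonotoneAlong_topSet j).identityPay_nonneg (posVec_nonneg v))]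
    exact identityPay_le_apply (posVec_nonneg v)
  have hsum_int : Integrable (fun v => ∑ j, ∫ c in Set.Ioc (0 : ℝ) 1,
      identityPay (winSet s c j) j (posVec v)) (Measure.pi F) :=
    integrable_finsetSum _ fun j _ => (hwin_int j).integral_prod_left
  have havg : ∫ v, ∑ j, (∫ c in Set.Ioc (0 : ℝ) 1, identityPay (winSet s c j) j (posVec v))
      ∂Measure.pi F ≤ sSup S := by
    calc _ = ∫ c in Set.Ioc (0 : ℝ) 1, ∑ j, ∫ v, identityPay (winSet s c j) j (posVec v)
          ∂Measure.pi F := by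
          rw [integral_finsetSum _ fun j _ => (hwin_int j).integral_prod_left,
            integral_finsetSum _ fun j _ => (hwin_int j).integral_prod_right]
          exact Finset.sum_congr rfl fun j _ => integral_integral_swap (hwin_int j)
      _ ≤ ∫ _ in Set.Ioc (0 : ℝ) 1, sSup S := by
          refine integral_mono_ae
            (integrable_finsetSum _ fun j _ => (hwin_int j).integral_prod_right)
            (integrable_const _) ?_
          filter_upwards [ae_all_iff.2 fun j => (hwin_int j).prod_left_ae] with c hc
          simp only [← integral_finsetSum Finset.univ fun j _ => hc j]
          exact hwin c
      _ = sSup S := by simp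
  calc lotteryRevenue (Measure.pi F) s
      ≤ ∫ v, ((∑ j, ∫ c in Set.Ioc (0 : ℝ) 1, identityPay (winSet s c j) j (posVec v)) +
          ∑ j, identityPay (topSet j) j (posVec v)) ∂Measure.pi F := by
        refine integral_mono_of_nonneg (.of_forall fun v => selP_nonneg _)
          (hsum_int.add (integrable_finsetSum _ fun j _ => hvick_int j)) ?_
        filter_upwards [ae_pi_nonneg F hF_nonneg] with v hv
        rw [posVec_of_nonneg hv]
        exact hs.selP_le_add hv
    _ ≤ 2 * sSup S := by
        rw [integral_add hsum_int (integrable_finsetSum _ fun j _ => hvick_int j)]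
        linarith
end
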